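/- Let F be a finite group and Γ = D∞ × F. Let w ∈ {0,1}^{D∞} be almost periodic for the D∞-shift, fixed by the order-two generator t of D∞ (t·w = w), and with infinite orbit closure in {0,1}^{D∞}. Let A = {0} ∪ {a_s : s ∈ F} be an alphabet of |F| + 1 pairwise distinct symbols; for each s ∈ F let w_s ∈ A^{D∞} be obtained from w by replacing every symbol 1 by a_s, and define x₀ ∈ A^Γ by x₀(g, s) = w_s(g). Then the subshift Γ ↷ O(x₀) is minimal and topologically free but not free. -/

import Mathlib

open scoped Pointwise
open MeasureTheory

namespace Paper

section Basic

variable (G : Type*) [Group G] (X : Type*) [TopologicalSpace X] [MulAction G X]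

/-- The action is minimal: every orbit is dense. -/
def Minimal : Prop := ∀ x : X, Dense (MulAction.orbit G x)

/-- The action is topologically free: every nontrivial fixed-point set is nowhere dense. -/
def TopFree : Prop := ∀ g : G, g ≠ 1 → interior (closure {x : X | g • x = x}) = (∅ : Set X)

variable [MeasurableSpace X]

/-- `μ` is a `G`-invariant Borel probability measure. -/
def InvProb (μ : Measure X) : Prop :=
  IsProbabilityMeasure μ ∧ ∀ g : G, Measure.map (fun x : X => g • x) μ = μ

/-- The action is essentially free. -/
def EssFree : Prop :=
  ∀ g : G, g ≠ 1 → ∀ μ : Measure X, InvProb G X μ → μ {x : X | g • x = x} = 0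

/-- The small boundary property. -/
def SBP : Prop :=
  ∀ (x : X) (U : Set X), IsOpen U → x ∈ U →
    ∃ V : Set X, IsOpen V ∧ x ∈ V ∧ V ⊆ U ∧
      ∀ μ : Measure X, InvProb G X μ → μ (frontier V) = 0

end Basic

/-- `S` is a `(K, ε)`-Følner set: `|KS \ S| < ε |S|`. -/
def IsFolner {G : Type*} [Group G] (K S : Finset G) (ε : ℝ) : Prop :=
  letI := Classical.decEq G
  (((K * S) \ S).card : ℝ) < ε * S.card

/-- Amenability in the Følner sense. -/
def FolnerAmenable (G : Type*) [Group G] : Prop :=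
  ∀ (K : Finset G) (ε : ℝ), 0 < ε → ∃ S : Finset G, IsFolner K S ε

/-- A finite family of towers forming a castle: all levels are pairwise disjoint. -/
def IsCastle (G : Type*) [Group G] (X : Type*) [MulAction G X] {n : ℕ}
    (S : Fin n → Finset G) (B : Fin n → Set X) : Prop :=
  ∀ (i j : Fin n), ∀ s ∈ S i, ∀ t ∈ S j, (i, s) ≠ (j, t) → Disjoint (s • B i) (t • B j)

/-- The union of all levels of a castle. -/
def CastleUnion (G : Type*) [Group G] (X : Type*) [MulAction G X] {n : ℕ}
    (S : Fin n → Finset G) (B : Fin n → Set X) : Set X :=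
  ⋃ i, ⋃ s ∈ S i, s • B i

/-- `C ≺ O` : dynamical subordination of a (closed) set `C` to `O`. -/
def Subord (G : Type*) [Group G] (X : Type*) [TopologicalSpace X] [MulAction G X]
    (C O : Set X) : Prop :=
  ∃ (n : ℕ) (V : Fin n → Set X) (g : Fin n → G),
    (∀ k, IsOpen (V k)) ∧ (C ⊆ ⋃ k, V k) ∧ (∀ k, g k • V k ⊆ O) ∧
      Pairwise fun k l => Disjoint (g k • V k) (g l • V l)

/-- `U ≺ O` for open `U`: every closed subset of `U` is subordinate to `O`. -/
def SubordOpen (G : Type*) [Group G] (X : Type*) [TopologicalSpace X] [MulAction G X]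
    (U O : Set X) : Prop :=
  ∀ C : Set X, IsClosed C → C ⊆ U → Subord G X C O

/-- Dynamical comparison. -/
def DynComparison (G : Type*) [Group G] (X : Type*) [TopologicalSpace X] [MulAction G X]
    [MeasurableSpace X] : Prop :=
  ∀ U O : Set X, IsOpen U → IsOpen O → U.Nonempty → O.Nonempty →
    (∀ μ : Measure X, InvProb G X μ → μ U < μ O) → SubordOpen G X U O

/-- Almost finiteness (Kerr). -/
def AlmostFinite (G X : Type*) [Group G] [MetricSpace X] [MulAction G X] : Prop :=
  ∀ (K : Finset G) (m : ℕ), 0 < m → ∀ ε : ℝ, 0 < ε →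
    ∃ (n : ℕ) (S : Fin n → Finset G) (B : Fin n → Set X),
      IsCastle G X S B ∧ (∀ i, IsOpen (B i)) ∧ (∀ i, IsFolner K (S i) ε) ∧
      (∀ i, ∀ s ∈ S i, Metric.diam (s • B i) < ε) ∧
      ∃ S' : Fin n → Finset G,
        (∀ i, S' i ⊆ S i ∧ ((S' i).card : ℝ) < (S i).card / m) ∧
        Subord G X (Set.univ \ CastleUnion G X S B) (CastleUnion G X S' B)

/-- Almost finiteness in measure (Kerr–Szabó). -/
def AlmostFiniteInMeasure (G X : Type*) [Group G] [MetricSpace X] [MulAction G X]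
    [MeasurableSpace X] : Prop :=
  ∀ (K : Finset G) (ε : ℝ), 0 < ε →
    ∃ (n : ℕ) (S : Fin n → Finset G) (B : Fin n → Set X),
      IsCastle G X S B ∧ (∀ i, IsOpen (B i)) ∧ (∀ i, IsFolner K (S i) ε) ∧
      (∀ i, ∀ s ∈ S i, Metric.diam (s • B i) < ε) ∧
      (⨆ μ : {μ : Measure X // InvProb G X μ},
        (μ : Measure X) (Set.univ \ CastleUnion G X S B)) < ENNReal.ofReal ε

/-- Every finitely generated subgroup is finite. -/
def LocallyFiniteGroup (G : Type*) [Group G] : Prop :=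
  ∀ H : Subgroup G, H.FG → (H : Set G).Finite

/-- `G` is virtually `ℤ`. -/
def VirtuallyZ (G : Type*) [Group G] : Prop :=
  ∃ H : Subgroup G, H.FiniteIndex ∧ Nonempty (H ≃* Multiplicative ℤ)

end Paper

namespace Paper

/-- The `n`-shift of a bi-infinite word: `(n • w)(m) = w(m - n)`. -/
def zShift {A : Type*} (n : ℤ) (w : ℤ → A) : ℤ → A := fun m => w (m - n)

/-- A syndetic subset of `ℤ`. -/
def zSyndetic (R : Set ℤ) : Prop := ∃ K : Finset ℤ, ∀ n : ℤ, ∃ k ∈ K, n - k ∈ R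

/-- `w` is almost periodic for the `ℤ`-shift. -/
def zAP {A : Type*} [TopologicalSpace A] (w : ℤ → A) : Prop :=
  ∀ U ∈ nhds w, zSyndetic {n : ℤ | zShift n w ∈ U}

/-- `w` is balanced: each recurrence set contains a symmetric syndetic set. -/
def zBalanced {A : Type*} [TopologicalSpace A] (w : ℤ → A) : Prop :=
  ∀ U ∈ nhds w, ∃ P : Set ℤ, zSyndetic P ∧ P ⊆ {n : ℤ | zShift n w ∈ U} ∧ ∀ n, n ∈ P ↔ -n ∈ P

/-- The amplified word `ŵ` on the infinite dihedral group `D∞ = DihedralGroup 0`: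
`ŵ(n) = w(n)` on the canonical copy `{r n}` of `ℤ`, and `ŵ(n·t) = w(-n)`,
i.e. `ŵ(sr m) = w(m)` (here `t = sr 0`). -/
def amplify {A : Type*} (w : ℤ → A) : DihedralGroup 0 → A
  | DihedralGroup.r i => w i
  | DihedralGroup.sr i => w i

/-- The left shift action of a group `Γ` on `A^Γ`: `(g • x)(h) = x(g⁻¹ h)`. -/
instance shiftMulAction (Γ A : Type*) [Group Γ] : MulAction Γ (Γ → A) where
  smul g x h := x (g⁻¹ * h)
  one_smul x := funext fun h => by
    show x ((1:Γ)⁻¹ * h) = x h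
    rw [inv_one, one_mul]
  mul_smul g₁ g₂ x := funext fun h => by
    show x ((g₁ * g₂)⁻¹ * h) = x (g₂⁻¹ * (g₁⁻¹ * h))
    rw [mul_inv_rev, mul_assoc]

/-- A syndetic subset of a group `Γ`: `K R = Γ` for some finite `K`. -/
def gSyndetic {Γ : Type*} [Group Γ] (R : Set Γ) : Prop :=
  ∃ K : Finset Γ, ∀ g : Γ, ∃ k ∈ K, k⁻¹ * g ∈ R

/-- `x ∈ A^Γ` is almost periodic for the left shift. -/
def APoint {Γ A : Type*} [Group Γ] [TopologicalSpace A] (x : Γ → A) : Prop :=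
  ∀ U ∈ nhds x, gSyndetic {g : Γ | g • x ∈ U}

/-- The orbit closure `O(x)` of `x ∈ A^Γ` under the left shift. -/
def OrbitClosure (Γ : Type*) [Group Γ] {A : Type*} [TopologicalSpace A] (x : Γ → A) :
    Set (Γ → A) :=
  closure (MulAction.orbit Γ x)

/-- The restriction of the shift action to an orbit closure. -/
instance orbitClosureMulAction (Γ : Type*) [Group Γ] {A : Type*} [TopologicalSpace A]
    (x : Γ → A) : MulAction Γ (OrbitClosure Γ x) where
  smul g y := ⟨g • (y : Γ → A), by
    have hc : Continuous (fun z : Γ → A => g • z) :=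
      continuous_pi fun h => continuous_apply (g⁻¹ * h)
    have h2 := image_closure_subset_closure_image (s := MulAction.orbit Γ x) hc
      ⟨(y : Γ → A), y.2, rfl⟩
    have h3 : (fun z : Γ → A => g • z) '' MulAction.orbit Γ x = MulAction.orbit Γ x := by
      rw [Set.image_smul, MulAction.smul_orbit]
    rw [h3] at h2
    exact h2⟩
  one_smul y := Subtype.ext (one_smul Γ (y : Γ → A))
  mul_smul g₁ g₂ y := Subtype.ext (mul_smul g₁ g₂ (y : Γ → A))

end Paper

namespace Paper

/-- The word `x₀ ∈ A^(D∞ × F)` from the paper: `x₀(g, s) = w_s(g)`, where `w_s` is obtained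
from the `{0,1}`-word `w` by replacing every symbol `1` by `a_s` and `0` by `z`. -/
def x0word {F A : Type*} (a : F → A) (z : A) (w : DihedralGroup 0 → Bool) :
    (DihedralGroup 0 × F) → A :=
  fun p => if w p.1 then a p.2 else z

end Paper

namespace Paper

lemma shift_apply {Γ A : Type*} [Group Γ] (g : Γ) (x : Γ → A) (h : Γ) :
    (g • x) h = x (g⁻¹ * h) := rfl

lemma continuous_shift {Γ A : Type*} [Group Γ] [TopologicalSpace A] (g : Γ) :
    Continuous (fun x : Γ → A => g • x) :=
  continuous_pi fun h => continuous_apply (g⁻¹ * h)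

/-- An almost periodic point lies in the orbit closure of every point of its orbit closure. -/
lemma APoint.mem_closure_orbit {Γ A : Type*} [Group Γ] [TopologicalSpace A] [RegularSpace A]
    {x y : Γ → A} (hx : APoint x) (hy : y ∈ OrbitClosure Γ x) :
    x ∈ closure (MulAction.orbit Γ y) := by
  rw [mem_closure_iff_nhds]
  intro U hU
  obtain ⟨V, hV, hVc, hVU⟩ := exists_mem_nhds_isClosed_subset hU
  obtain ⟨K, hK⟩ := hx V hV
  have hclosed : IsClosed (⋃ k ∈ K, (fun v : Γ → A => k⁻¹ • v) ⁻¹' V) :=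
    K.finite_toSet.isClosed_biUnion fun k _ => hVc.preimage (continuous_shift k⁻¹)
  have hsub : MulAction.orbit Γ x ⊆ ⋃ k ∈ K, (fun v : Γ → A => k⁻¹ • v) ⁻¹' V := by
    rintro _ ⟨g, rfl⟩
    obtain ⟨k, hk, hkg⟩ := hK g
    simp only [Set.mem_iUnion]
    refine ⟨k, hk, ?_⟩
    simpa [mul_smul] using hkg
  have hmem := closure_minimal hsub hclosed hy
  simp only [Set.mem_iUnion] at hmem
  obtain ⟨k, -, hk⟩ := hmem
  exact ⟨k⁻¹ • y, hVU hk, k⁻¹, rfl⟩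

lemma coe_smul_orbitClosure {Γ A : Type*} [Group Γ] [TopologicalSpace A] {x : Γ → A} (g : Γ)
    (y : OrbitClosure Γ x) : ((g • y : OrbitClosure Γ x) : Γ → A) = g • (y : Γ → A) := rfl

/-- The orbit closure of an almost periodic point is a minimal subshift. -/
lemma APoint.minimal {Γ A : Type*} [Group Γ] [TopologicalSpace A] [RegularSpace A]
    {x : Γ → A} (hx : APoint x) : Minimal Γ (OrbitClosure Γ x) := by
  intro y
  have himage : Subtype.val '' MulAction.orbit Γ y = MulAction.orbit Γ (y : Γ → A) := by
    ext v
    constructor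
    · rintro ⟨_, ⟨g, rfl⟩, rfl⟩
      exact ⟨g, rfl⟩
    · rintro ⟨g, rfl⟩
      exact ⟨g • y, ⟨g, rfl⟩, rfl⟩
  have hsub : MulAction.orbit Γ x ⊆ closure (MulAction.orbit Γ (y : Γ → A)) := by
    rintro _ ⟨g, rfl⟩
    have h := image_closure_subset_closure_image (continuous_shift g)
      ⟨x, hx.mem_closure_orbit y.2, rfl⟩
    rwa [Set.image_smul, MulAction.smul_orbit] at h
  intro v
  rw [closure_subtype, himage]
  exact closure_minimal hsub isClosed_closure v.2

/-- If `g` fixes a nonempty open subset of an orbit closure, then some conjugate of `g` fixes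
every translate of `x` that is close to `x`. -/
lemma exists_conj_fixed_near {Γ A : Type*} [Group Γ] [TopologicalSpace A] [T2Space A]
    {x : Γ → A} {g : Γ}
    (hg : interior (closure {y : OrbitClosure Γ x | g • y = y}) ≠ ∅) :
    ∃ c : Γ, ∃ U ∈ nhds x, ∀ k : Γ, k • x ∈ U → (c⁻¹ * g * c) • k • x = k • x := by
  obtain ⟨y, hy⟩ := Set.nonempty_iff_ne_empty.mpr hg
  have hclosed : IsClosed {y : OrbitClosure Γ x | g • y = y} := by
    have : {y : OrbitClosure Γ x | g • y = y} =
        {y : OrbitClosure Γ x | g • (y : Γ → A) = y} := by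
      ext y
      exact Subtype.ext_iff
    rw [this]
    exact isClosed_eq ((continuous_shift g).comp continuous_subtype_val) continuous_subtype_val
  rw [hclosed.closure_eq] at hy
  obtain ⟨W, hW, hWint⟩ := isOpen_induced_iff.mp
    (isOpen_interior (s := {y : OrbitClosure Γ x | g • y = y}))
  have hyW : (y : Γ → A) ∈ W := by
    rw [← hWint] at hy
    exact hy
  obtain ⟨_, hcW, c, rfl⟩ := mem_closure_iff.mp y.2 W hW hyW
  refine ⟨c, (fun v : Γ → A => c • v) ⁻¹' W,
    (hW.preimage (continuous_shift c)).mem_nhds hcW, fun k hk => ?_⟩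
  have hmem : (⟨(c * k) • x, subset_closure ⟨c * k, rfl⟩⟩ : OrbitClosure Γ x) ∈
      interior {y : OrbitClosure Γ x | g • y = y} := by
    rw [← hWint]
    change (c * k) • x ∈ W
    rw [mul_smul]
    exact hk
  have hmem' := interior_subset hmem
  have hfixed : g • (c * k) • x = (c * k) • x := congrArg Subtype.val hmem'
  rw [mul_smul, mul_smul, ← mul_smul c k x, hfixed, mul_smul, inv_smul_smul]

lemma finite_orbitClosure {Γ A : Type*} [Group Γ] [TopologicalSpace A] [T1Space A]
    {x : Γ → A} (h : (MulAction.orbit Γ x).Finite) : (OrbitClosure Γ x).Finite := by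
  rw [OrbitClosure, h.isClosed.closure_eq]
  exact h

/-- A syndetic subset of an infinite group is infinite. -/
lemma gSyndetic.infinite {Γ : Type*} [Group Γ] [Infinite Γ] {R : Set Γ} (hR : gSyndetic R) :
    R.Infinite := by
  intro hfin
  obtain ⟨K, hK⟩ := hR
  refine Set.infinite_univ (α := Γ) ((Set.Finite.mul K.finite_toSet hfin).subset fun g _ => ?_)
  obtain ⟨k, hk, hkg⟩ := hK g
  exact ⟨k, hk, k⁻¹ * g, hkg, mul_inv_cancel_left k g⟩

instance : Infinite (DihedralGroup 0) :=
  Infinite.of_injective (fun i : ℤ => (DihedralGroup.r (n := 0) i)) fun _ _ h =>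
    DihedralGroup.r.inj h

/-- The rotation of `D∞` by an integer. -/
def rot (i : ℤ) : DihedralGroup 0 := DihedralGroup.r (i : ZMod 0)

/-- The reflection of `D∞` indexed by an integer. -/
def refl (i : ℤ) : DihedralGroup 0 := DihedralGroup.sr (i : ZMod 0)

lemma eq_rot_or_eq_refl (g : DihedralGroup 0) : (∃ i, g = rot i) ∨ ∃ i, g = refl i := by
  rcases g with i | i
  · exact Or.inl ⟨i, rfl⟩
  · exact Or.inr ⟨i, rfl⟩

lemma rot_zero : rot 0 = 1 := rfl

lemma rot_mul_rot (i j : ℤ) : rot i * rot j = rot (i + j) := rfl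

lemma rot_mul_refl (i j : ℤ) : rot i * refl j = refl (j - i) := rfl

lemma refl_mul_rot (i j : ℤ) : refl i * rot j = refl (i + j) := rfl

lemma refl_mul_refl (i j : ℤ) : refl i * refl j = rot (j - i) := rfl

lemma inv_rot (i : ℤ) : (rot i)⁻¹ = rot (-i) := rfl

lemma inv_refl (i : ℤ) : (refl i)⁻¹ = refl i := rfl

lemma rot_zpow (n q : ℤ) : rot n ^ q = rot (n * q) := by
  induction q using Int.induction_on with
  | zero => rw [zpow_zero, mul_zero, rot_zero]
  | succ i ih => rw [zpow_add_one, ih, rot_mul_rot, mul_add, mul_one]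
  | pred i ih => rw [zpow_sub_one, ih, inv_rot, rot_mul_rot, mul_sub, mul_one, sub_eq_add_neg]

/-- A point of a `D∞`-space fixed by a nontrivial rotation has finite orbit. -/
lemma finite_orbit_of_rot_smul {X : Type*} [MulAction (DihedralGroup 0) X] {x : X} {n : ℤ}
    (hn : n ≠ 0) (hx : rot n • x = x) : (MulAction.orbit (DihedralGroup 0) x).Finite := by
  have hmod : ∀ i : ℤ, rot i • x = rot (i % n) • x := by
    intro i
    have hmem : rot n ^ (i / n) ∈ MulAction.stabilizer (DihedralGroup 0) x :=
      Subgroup.zpow_mem _ hx _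
    rw [rot_zpow] at hmem
    conv_lhs => rw [← Int.emod_add_mul_ediv i n, ← rot_mul_rot, mul_smul,
      MulAction.mem_stabilizer_iff.mp hmem]
  have hrot : (Set.range fun i : ℤ => rot i • x).Finite := by
    refine ((Set.finite_Ico (0 : ℤ) |n|).image fun i : ℤ => rot i • x).subset ?_
    rintro _ ⟨i, rfl⟩
    exact ⟨i % n, ⟨Int.emod_nonneg i hn, Int.emod_lt_abs i hn⟩, (hmod i).symm⟩
  refine (hrot.union (hrot.image fun y => refl 0 • y)).subset ?_
  rintro _ ⟨g, rfl⟩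
  rcases eq_rot_or_eq_refl g with ⟨i, rfl⟩ | ⟨i, rfl⟩
  · exact Or.inl ⟨i, rfl⟩
  · refine Or.inr ⟨_, ⟨i, rfl⟩, ?_⟩
    change refl 0 • rot i • x = refl i • x
    rw [← mul_smul, refl_mul_rot, zero_add]

/-- If infinitely many conjugates `k⁻¹ g k` of a nontrivial `g ∈ D∞` fix `x`, then `x` has finite
orbit. -/
lemma finite_orbit_of_infinite_conj {X : Type*} [MulAction (DihedralGroup 0) X] {x : X}
    {g : DihedralGroup 0} (hg : g ≠ 1) {R : Set (DihedralGroup 0)} (hR : R.Infinite)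
    (hfix : ∀ k ∈ R, g • k • x = k • x) : (MulAction.orbit (DihedralGroup 0) x).Finite := by
  have hstab : ∀ k ∈ R, k⁻¹ * g * k ∈ MulAction.stabilizer (DihedralGroup 0) x := by
    intro k hk
    rw [MulAction.mem_stabilizer_iff, mul_smul, mul_smul, hfix k hk, inv_smul_smul]
  by_contra hinf
  have hrot : ∀ n, rot n ∈ MulAction.stabilizer (DihedralGroup 0) x → n = 0 := by
    intro n hn
    by_contra hn0
    exact hinf (finite_orbit_of_rot_smul hn0 hn)
  have hrefl : ∀ i j, refl i ∈ MulAction.stabilizer (DihedralGroup 0) x →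
      refl j ∈ MulAction.stabilizer (DihedralGroup 0) x → i = j := by
    intro i j hi hj
    have h := mul_mem hi hj
    rw [refl_mul_refl] at h
    exact (sub_eq_zero.mp (hrot _ h)).symm
  obtain ⟨k₀, hk₀⟩ := hR.nonempty
  rcases eq_rot_or_eq_refl g with ⟨n, rfl⟩ | ⟨m, rfl⟩
  · have h := hstab k₀ hk₀
    have hn : n = 0 := by
      rcases eq_rot_or_eq_refl k₀ with ⟨i, rfl⟩ | ⟨i, rfl⟩
      · rw [inv_rot, rot_mul_rot, rot_mul_rot] at h
        linarith [hrot _ h]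
      · rw [inv_refl, refl_mul_rot, refl_mul_refl] at h
        linarith [hrot _ h]
    exact hg (by rw [hn, rot_zero])
  · have hconj_rot : ∀ i, (rot i)⁻¹ * refl m * rot i = refl (m + 2 * i) := by
      intro i
      rw [inv_rot, rot_mul_refl, refl_mul_rot]
      congr 1
      ring
    have hconj_refl : ∀ i, (refl i)⁻¹ * refl m * refl i = refl (2 * i - m) := by
      intro i
      rw [inv_refl, refl_mul_refl, rot_mul_refl]
      congr 1
      ring
    obtain ⟨j, hj⟩ : ∃ j, k₀⁻¹ * refl m * k₀ = refl j := by
      rcases eq_rot_or_eq_refl k₀ with ⟨i, rfl⟩ | ⟨i, rfl⟩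
      · exact ⟨_, hconj_rot i⟩
      · exact ⟨_, hconj_refl i⟩
    have hjs := hstab k₀ hk₀
    rw [hj] at hjs
    refine hR ((Set.toFinite {rot ((j - m) / 2), refl ((j + m) / 2)}).subset ?_)
    intro k hk
    have h := hstab k hk
    rcases eq_rot_or_eq_refl k with ⟨i, rfl⟩ | ⟨i, rfl⟩
    · rw [hconj_rot] at h
      have he := hrefl _ _ h hjs
      exact Or.inl (congrArg rot (by lia))
    · rw [hconj_refl] at h
      have he := hrefl _ _ h hjs
      exact Or.inr (congrArg refl (by lia))

section X0word

variable {F A : Type*} (a : F → A) (z : A)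

lemma continuous_x0word [TopologicalSpace A] :
    Continuous (x0word a z : (DihedralGroup 0 → Bool) → DihedralGroup 0 × F → A) :=
  continuous_pi fun p =>
    (continuous_of_discreteTopology (f := fun b : Bool => if b then a p.2 else z)).comp
      (continuous_apply p.1)

variable [Group F]

lemma smul_x0word (g : DihedralGroup 0) (w : DihedralGroup 0 → Bool) :
    ((g, 1) : DihedralGroup 0 × F) • x0word a z w = x0word a z (g • w) := by
  funext p
  simp [shift_apply, x0word]

variable {a z}

lemma x0word_injective (hz : ∀ s : F, a s ≠ z) :
    Function.Injective (x0word a z : (DihedralGroup 0 → Bool) → DihedralGroup 0 × F → A) := by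
  intro v w h
  funext g
  have hg := congrFun h (g, 1)
  simp only [x0word] at hg
  cases hv : v g <;> cases hw : w g <;> simp_all [(hz 1).symm]

lemma APoint.x0word [Fintype F] [TopologicalSpace A] {w : DihedralGroup 0 → Bool}
    (hw : APoint w) : APoint (x0word a z w) := by
  intro U hU
  obtain ⟨K, hK⟩ := hw _ ((continuous_x0word a z).continuousAt.preimage_mem_nhds hU)
  refine ⟨K ×ˢ Finset.univ, fun g => ?_⟩
  obtain ⟨k, hk, hkg⟩ := hK g.1
  refine ⟨(k, g.2), by simpa using hk, ?_⟩
  have hmul : ((k, g.2) : DihedralGroup 0 × F)⁻¹ * g = (k⁻¹ * g.1, 1) :=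
    Prod.ext rfl (inv_mul_cancel g.2)
  rw [hmul]
  change ((k⁻¹ * g.1, 1) : DihedralGroup 0 × F) • Paper.x0word a z w ∈ U
  rw [smul_x0word]
  exact hkg

/-- An element with nontrivial `F`-coordinate only fixes `x0word a z w` if `w` vanishes. -/
lemma eq_false_of_smul_x0word_eq (hinj : Function.Injective a) (hz : ∀ s : F, a s ≠ z)
    {w : DihedralGroup 0 → Bool} {g : DihedralGroup 0 × F} (hg : g.2 ≠ 1)
    (h : g • x0word a z w = x0word a z w) : w = fun _ => false := by
  funext d
  have hd := congrFun h (d, 1)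
  simp only [shift_apply, x0word, Prod.fst_mul, Prod.snd_mul, Prod.fst_inv, Prod.snd_inv,
    mul_one] at hd
  by_contra hne
  rw [Bool.not_eq_false] at hne
  rw [hne, if_pos rfl] at hd
  split_ifs at hd
  · exact hg (inv_eq_one.mp (hinj hd))
  · exact hz 1 hd.symm

end X0word

/-- The subshift generated by `x0word a z w` is topologically free. -/
lemma topFree_x0word {F A : Type*} [Group F] [TopologicalSpace A] [T2Space A]
    {a : F → A} {z : A} (hinj : Function.Injective a) (hz : ∀ s : F, a s ≠ z)
    {w : DihedralGroup 0 → Bool} (hw : APoint w)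
    (hinf : (OrbitClosure (DihedralGroup 0) w).Infinite) :
    TopFree (DihedralGroup 0 × F) (OrbitClosure (DihedralGroup 0 × F) (x0word a z w)) := by
  intro g hg
  by_contra hne
  obtain ⟨c, U, hU, hfix⟩ := exists_conj_fixed_near hne
  have hconj : c⁻¹ * g * c ≠ 1 := by
    intro h
    apply hg
    simpa using (conj_eq_one_iff (a := c⁻¹) (b := g)).mp (by simpa using h)
  generalize c⁻¹ * g * c = h at hfix hconj
  refine hinf (finite_orbitClosure ?_)
  by_cases hs : h.2 = 1
  · obtain ⟨d, s⟩ := h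
    obtain rfl : s = 1 := hs
    have hd : d ≠ 1 := fun hd => hconj (by rw [hd]; rfl)
    refine finite_orbit_of_infinite_conj hd
      (hw _ ((continuous_x0word a z).continuousAt.preimage_mem_nhds hU)).infinite
      fun k hk => x0word_injective hz ?_
    have hk' := hfix (k, 1) (by rw [smul_x0word]; exact hk)
    rwa [smul_x0word, smul_x0word] at hk'
  · have hx : h • x0word a z w = x0word a z w := by
      have h1 := hfix 1
      rw [one_smul] at h1
      exact h1 (mem_of_mem_nhds hU)
    refine (Set.finite_singleton w).subset ?_
    rintro _ ⟨k, rfl⟩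
    rw [eq_false_of_smul_x0word_eq hinj hz hs hx]
    rfl

end Paper

open Paper

set_option synthInstance.maxHeartbeats 1000000 in
theorem x0_subshift_minimal_topFree_notFree
    (F : Type*) [Group F] [Fintype F]
    (A : Type*) [TopologicalSpace A] [DiscreteTopology A]
    (a : F → A) (z : A) (hinj : Function.Injective a) (hz : ∀ s : F, a s ≠ z)
    (hA : ∀ b : A, b = z ∨ ∃ s : F, b = a s)
    (w : DihedralGroup 0 → Bool) (hw : APoint w)
    (hfix : (DihedralGroup.sr 0 : DihedralGroup 0) • w = w)
    (hinf : (OrbitClosure (DihedralGroup 0) w).Infinite) :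
    Minimal (DihedralGroup 0 × F) (OrbitClosure (DihedralGroup 0 × F) (x0word a z w)) ∧
    TopFree (DihedralGroup 0 × F) (OrbitClosure (DihedralGroup 0 × F) (x0word a z w)) ∧
    ¬ (∀ (g : DihedralGroup 0 × F)
        (y : OrbitClosure (DihedralGroup 0 × F) (x0word a z w)),
        g • y = y → g = 1) := by
  refine ⟨hw.x0word.minimal, topFree_x0word hinj hz hw hinf, fun hfree => ?_⟩
  have h := hfree (DihedralGroup.sr 0, 1) ⟨x0word a z w, subset_closure ⟨1, one_smul _ _⟩⟩
    (Subtype.ext (by rw [coe_smul_orbitClosure, smul_x0word, hfix]))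
  exact nomatch congrArg Prod.fst h
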